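/- (Subset / total-photon-number reduction.) Let M ≥ 1, let A ∈ ℂ^{2M×2M} be symmetric, let γ ∈ ℂ^{2M}, and let Y ⊆ {1,…,M}. Let A_Y ∈ ℂ^{2|Y|×2|Y|} and γ_Y ∈ ℂ^{2|Y|} be obtained from A and γ by keeping only the rows/columns (respectively entries) with indices k and M+k for k ∈ Y. Then for every N ∈ ℕ, Σ over n ∈ ℕ^M with n_k = 0 for all k ∉ Y and n_1+⋯+n_M = N of lhaf(A_{n⊕n}, γ_{n⊕n}) / Π_{i=1}^M n_i! equals f_N(A_Y, γ_Y, (1,…,1)), where f_N is formed with the 2|Y|×2|Y| swap matrix [[0, I_{|Y|}],[I_{|Y|}, 0]] and the all-ones vector (1,…,1) ∈ ℂ^{|Y|}. -/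

import Mathlib

open Matrix

noncomputable section

/-- The loop Hafnian of a matrix `B`: the sum over all involutions `σ` of `{0,…,d-1}`
of the product over `i ≤ σ i` of `B i (σ i)`. -/
def lhaf {d : ℕ} (B : Matrix (Fin d) (Fin d) ℂ) : ℂ :=
  ∑ σ ∈ Finset.univ.filter (fun σ : Equiv.Perm (Fin d) => σ * σ = 1),
    ∏ i ∈ Finset.univ.filter (fun i => i ≤ σ i), B i (σ i)

/-- `filldiag A γ` is `A` with its diagonal overwritten by the entries of `γ`. -/
def filldiag {d : ℕ} (A : Matrix (Fin d) (Fin d) ℂ) (γ : Fin d → ℂ) :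
    Matrix (Fin d) (Fin d) ℂ :=
  Matrix.of fun i j => if i = j then γ i else A i j

/-- `lhaf(A, γ) := lhaf(filldiag(A, γ))`. -/
def lhafv {d : ℕ} (A : Matrix (Fin d) (Fin d) ℂ) (γ : Fin d → ℂ) : ℂ :=
  lhaf (filldiag A γ)

/-- The list containing `n k` consecutive copies of `k`, for `k = 0, 1, …, M-1` in order. -/
def repList {M : ℕ} (n : Fin M → ℕ) : List (Fin M) :=
  (List.finRange M).flatMap fun k => List.replicate (n k) k

lemma repList_length {M : ℕ} (n : Fin M → ℕ) : (repList n).length = ∑ k, n k := by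
  simp only [repList, List.length_flatMap, Fin.sum_univ_def, List.map_map]
  congr 1
  simp [Function.comp]

/-- The repetition map sending each of the `∑ k, n k` indices to the original index of
which it is a copy (`n k` copies of `k`, in order). -/
def rep {M : ℕ} (n : Fin M → ℕ) (i : Fin (∑ k, n k)) : Fin M :=
  (repList n).get (Fin.cast (repList_length n).symm i)

/-- The doubled repetition map: the first `∑ k, n k` indices are copies of the "left"
indices (`n k` copies of `inl k`), the last `∑ k, m k` are copies of the "right" indices
(`m k` copies of `inr k`). -/
def dbl {M : ℕ} (n m : Fin M → ℕ) :
    Fin ((∑ k, n k) + (∑ k, m k)) → Fin M ⊕ Fin M :=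
  (Sum.map (rep n) (rep m)) ∘ finSumFinEquiv.symm

/-- `A_{n⊕m}`: the matrix obtained from a `2M × 2M` matrix `A` (indexed by
`Fin M ⊕ Fin M`) by taking `n k` copies of the `k`-th row/column and `m k` copies of the
`(M+k)`-th row/column. -/
def repMat {M : ℕ} (A : Matrix (Fin M ⊕ Fin M) (Fin M ⊕ Fin M) ℂ) (n m : Fin M → ℕ) :
    Matrix (Fin ((∑ k, n k) + (∑ k, m k))) (Fin ((∑ k, n k) + (∑ k, m k))) ℂ :=
  A.submatrix (dbl n m) (dbl n m)

/-- `γ_{n⊕m}`: the vector obtained from `γ` by taking `n k` copies of the `k`-th entry and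
`m k` copies of the `(M+k)`-th entry. -/
def repVec {M : ℕ} (γ : Fin M ⊕ Fin M → ℂ) (n m : Fin M → ℕ) :
    Fin ((∑ k, n k) + (∑ k, m k)) → ℂ :=
  γ ∘ dbl n m

/-- The swap matrix `X = [[0, I],[I, 0]]`. -/
def Xmat (ι : Type*) [DecidableEq ι] [Fintype ι] (R : Type*) [CommRing R] :
    Matrix (ι ⊕ ι) (ι ⊕ ι) R :=
  Matrix.fromBlocks 0 1 1 0

/-- `D(z) = diag(z) ⊕ diag(z)`. -/
def Dmat {ι : Type*} [DecidableEq ι] {R : Type*} [CommRing R] (z : ι → R) :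
    Matrix (ι ⊕ ι) (ι ⊕ ι) R :=
  Matrix.diagonal (Sum.elim z z)

/-- `g_k(A,γ,z) = tr((D(z)XA)^k)/(2k) + (1/2)·γᵀ (D(z)XA)^{k-1} D(z)X γ`. -/
def gfun {ι : Type*} [Fintype ι] [DecidableEq ι] {R : Type*} [CommRing R]
    (A : Matrix (ι ⊕ ι) (ι ⊕ ι) R) (γ : ι ⊕ ι → R) (z : ι → R) (k : ℕ) : R :=
  Ring.inverse ((2 * k : ℕ) : R) * Matrix.trace ((Dmat z * Xmat ι R * A) ^ k)
    + Ring.inverse (2 : R) *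
        (γ ⬝ᵥ Matrix.mulVec ((Dmat z * Xmat ι R * A) ^ (k - 1) * (Dmat z * Xmat ι R)) γ)

/-- `f_N(A,γ,z)`: the coefficient of `η^N` in `Σ_{j=0}^N (1/j!)(Σ_{k=1}^N g_k(A,γ,z) η^k)^j`. -/
def fN {ι : Type*} [Fintype ι] [DecidableEq ι] {R : Type*} [CommRing R]
    (N : ℕ) (A : Matrix (ι ⊕ ι) (ι ⊕ ι) R) (γ : ι ⊕ ι → R) (z : ι → R) : R :=
  Polynomial.coeff
    (∑ j ∈ Finset.range (N + 1),
      Polynomial.C (Ring.inverse ((j.factorial : ℕ) : R)) *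
        (∑ k ∈ Finset.Icc 1 N, Polynomial.C (gfun A γ z k) * Polynomial.X ^ k) ^ j) N


/-- The derivation with `X b ↦ A a b`. -/
def dl {σ : Type*} (A : Matrix σ σ ℂ) (a : σ) :
    Derivation ℂ (MvPolynomial σ ℂ) (MvPolynomial σ ℂ) :=
  MvPolynomial.mkDerivation ℂ (fun b => MvPolynomial.C (A a b))

lemma dl_X {σ : Type*} (A : Matrix σ σ ℂ) (a b : σ) :
    dl A a (MvPolynomial.X b) = MvPolynomial.C (A a b) := by
  simp [dl, MvPolynomial.mkDerivation_X]

lemma dl_X_mul {σ : Type*} (A : Matrix σ σ ℂ) (a b : σ) (p : MvPolynomial σ ℂ) :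
    dl A a (MvPolynomial.X b * p)
      = MvPolynomial.X b * dl A a p + MvPolynomial.C (A a b) * p := by
  rw [Derivation.leibniz, dl_X]; simp [smul_eq_mul, mul_comm]

lemma dl_C_mul {σ : Type*} (A : Matrix σ σ ℂ) (a : σ) (c : ℂ) (p : MvPolynomial σ ℂ) :
    dl A a (MvPolynomial.C c * p) = MvPolynomial.C c * dl A a p := by
  rw [← MvPolynomial.smul_eq_C_mul, ← MvPolynomial.smul_eq_C_mul, Derivation.map_smul]

/-- `H` is the Gaussian moment functional with mean `γ` and covariance `A`. -/
def IsMom {σ : Type*} (A : Matrix σ σ ℂ) (γ : σ → ℂ)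
    (H : MvPolynomial σ ℂ →ₗ[ℂ] ℂ) : Prop :=
  H 1 = 1 ∧ ∀ a p, H (MvPolynomial.X a * p) = γ a * H p + H (dl A a p)

/-- The twisted multiplication operators. -/
def tw {σ : Type*} (A : Matrix σ σ ℂ) (γ : σ → ℂ) (a : σ) :
    MvPolynomial σ ℂ →ₗ[ℂ] MvPolynomial σ ℂ :=
  LinearMap.mulLeft ℂ (MvPolynomial.X a + MvPolynomial.C (γ a)) + (dl A a).toLinearMap

lemma tw_apply {σ : Type*} (A : Matrix σ σ ℂ) (γ : σ → ℂ) (a : σ) (p : MvPolynomial σ ℂ) :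
    tw A γ a p = MvPolynomial.X a * p + MvPolynomial.C (γ a) * p + dl A a p := by
  simp [tw, add_mul]

lemma dl_comm {σ : Type*} (A : Matrix σ σ ℂ) (a b : σ) (p : MvPolynomial σ ℂ) :
    dl A a (dl A b p) = dl A b (dl A a p) := by
  have h : ⁅dl A a, dl A b⁆ = 0 := by
    apply MvPolynomial.derivation_ext
    intro i
    simp [Derivation.commutator_apply, dl_X, ← MvPolynomial.algebraMap_eq]
  have := congrArg (fun D => D p) h
  simpa [Derivation.commutator_apply, sub_eq_zero] using this

lemma dl_tw {σ : Type*} (A : Matrix σ σ ℂ) (γ : σ → ℂ) (a b : σ) (p : MvPolynomial σ ℂ) :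
    dl A a (tw A γ b p) = tw A γ b (dl A a p) + MvPolynomial.C (A a b) * p := by
  simp only [tw_apply, map_add, dl_X_mul, dl_C_mul, dl_comm A a b]
  ring

lemma tw_comm {σ : Type*} (A : Matrix σ σ ℂ) (hA : A.IsSymm) (γ : σ → ℂ) (a b : σ)
    (p : MvPolynomial σ ℂ) :
    tw A γ a (tw A γ b p) = tw A γ b (tw A γ a p) := by
  rw [tw_apply A γ a, dl_tw, tw_apply A γ b (tw A γ a p), dl_tw A γ b a, hA.apply a b]
  simp only [tw_apply, dl_comm A a b]
  ring

/-- The image of `s` under repeated application of the twisted operators to `1`. -/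
def twProd {σ : Type*} (A : Matrix σ σ ℂ) (hA : A.IsSymm) (γ : σ → ℂ) (s : Multiset σ) :
    MvPolynomial σ ℂ :=
  haveI : LeftCommutative (fun (a : σ) (p : MvPolynomial σ ℂ) => tw A γ a p) :=
    ⟨tw_comm A hA γ⟩
  Multiset.foldr (fun (a : σ) (p : MvPolynomial σ ℂ) => tw A γ a p) 1 s

lemma twProd_cons {σ : Type*} (A : Matrix σ σ ℂ) (hA : A.IsSymm) (γ : σ → ℂ) (a : σ)
    (s : Multiset σ) : twProd A hA γ (a ::ₘ s) = tw A γ a (twProd A hA γ s) := by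
  simp [twProd]

lemma twProd_zero {σ : Type*} (A : Matrix σ σ ℂ) (hA : A.IsSymm) (γ : σ → ℂ) :
    twProd A hA γ 0 = 1 := by
  simp [twProd]

theorem exists_mom {σ : Type*} (A : Matrix σ σ ℂ) (hA : A.IsSymm) (γ : σ → ℂ) :
    ∃ H, IsMom A γ H := by
  classical
  let Φ : MvPolynomial σ ℂ →ₗ[ℂ] MvPolynomial σ ℂ :=
    (MvPolynomial.basisMonomials σ ℂ).constr ℂ
      (fun s => twProd A hA γ (Finsupp.toMultiset s))
  have hm : ∀ s, Φ (MvPolynomial.monomial s 1) = twProd A hA γ (Finsupp.toMultiset s) := by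
    intro s
    have := (MvPolynomial.basisMonomials σ ℂ).constr_basis ℂ
      (fun s => twProd A hA γ (Finsupp.toMultiset s)) s
    simpa [Φ] using this
  have h1 : Φ 1 = 1 := by
    have := hm 0
    simpa [twProd_zero] using this
  have hX : ∀ a p, Φ (MvPolynomial.X a * p) = tw A γ a (Φ p) := by
    intro a p
    have : Φ ∘ₗ LinearMap.mulLeft ℂ (MvPolynomial.X a) = tw A γ a ∘ₗ Φ := by
      apply (MvPolynomial.basisMonomials σ ℂ).ext
      intro s
      simp only [MvPolynomial.coe_basisMonomials, LinearMap.comp_apply, LinearMap.mulLeft_apply,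
        hm]
      rw [MvPolynomial.X, MvPolynomial.monomial_mul, one_mul, hm]
      simp [Finsupp.toMultiset_single, twProd_cons]
    exact congrArg (fun f => f p) this
  have hC : ∀ (c : ℂ) p, Φ (MvPolynomial.C c * p) = MvPolynomial.C c * Φ p := by
    intro c p
    rw [← MvPolynomial.smul_eq_C_mul, ← MvPolynomial.smul_eq_C_mul, map_smul]
  have hd : ∀ a p, dl A a (Φ p) = Φ (dl A a p) := by
    intro a p
    induction p using MvPolynomial.induction_on with
    | C c =>
      have h := hC c 1
      rw [mul_one, h1, mul_one] at h
      rw [h]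
      simp [← MvPolynomial.algebraMap_eq]
    | add p q hp hq => simp only [map_add, hp, hq]
    | mul_X p i hp =>
      rw [mul_comm, hX, dl_tw, hp, dl_X_mul, map_add, hX, hC]
  refine ⟨(MvPolynomial.aeval (fun _ => (0 : ℂ))).toLinearMap ∘ₗ Φ, by simp [h1], ?_⟩
  intro a p
  simp [hX, tw_apply, hd]

lemma dl_prod {σ α : Type*} [DecidableEq α] (A : Matrix σ σ ℂ) (φ : α → σ) (a : σ)
    (t : Finset α) :
    dl A a (∏ i ∈ t, MvPolynomial.X (φ i))
      = ∑ j ∈ t, MvPolynomial.C (A a (φ j)) * ∏ i ∈ t.erase j, MvPolynomial.X (φ i) := by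
  induction t using Finset.induction_on with
  | empty => simp
  | insert c t hc ih =>
    rw [Finset.prod_insert hc, dl_X_mul, ih, Finset.sum_insert hc, Finset.erase_insert hc,
      Finset.mul_sum, add_comm]
    congr 1
    apply Finset.sum_congr rfl
    intro j hj
    have : c ≠ j := fun h => hc (h ▸ hj)
    rw [Finset.erase_insert_of_ne this, Finset.prod_insert (by simp [hc])]
    ring

/-- Loop Hafnian restricted to a subset. -/
def lhS {α : Type*} [Fintype α] [LinearOrder α] (B : α → α → ℂ) (s : Finset α) : ℂ :=
  ∑ σ ∈ Finset.univ.filter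
      (fun σ : Equiv.Perm α => σ * σ = 1 ∧ ∀ i, i ∉ s → σ i = i),
    ∏ i ∈ s.filter (fun i => i ≤ σ i), B i (σ i)

lemma lhS_empty {α : Type*} [Fintype α] [LinearOrder α] (B : α → α → ℂ) :
    lhS B ∅ = 1 := by
  have : (Finset.univ.filter
      (fun σ : Equiv.Perm α => σ * σ = 1 ∧ ∀ i, i ∉ (∅ : Finset α) → σ i = i)) = {1} := by
    ext σ
    simp only [Finset.mem_filter, Finset.mem_univ, true_and, Finset.mem_singleton]
    constructor
    · rintro ⟨-, h⟩
      ext i; simpa using h i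
    · rintro rfl; simp
  rw [lhS, this]; simp

lemma lhS_insert {α : Type*} [Fintype α] [LinearOrder α] (B : α → α → ℂ) (t : Finset α)
    (a : α) (ha : ∀ b ∈ t, a < b) :
    lhS B (insert a t) = B a a * lhS B t + ∑ b ∈ t, B a b * lhS B (t.erase b) := by
  have hat : a ∉ t := fun h => lt_irrefl _ (ha a h)
  have key : ∀ b ∈ insert a t,
      ∑ σ ∈ (Finset.univ.filter
        (fun σ : Equiv.Perm α => σ * σ = 1 ∧ ∀ i, i ∉ insert a t → σ i = i)).filter
          (fun σ => σ a = b),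
        ∏ i ∈ (insert a t).filter (fun i => i ≤ σ i), B i (σ i)
      = B a b * lhS B (t.erase b) := by
    intro b hb
    have hab : a ≤ b := by
      rcases Finset.mem_insert.1 hb with rfl | h
      · exact le_rfl
      · exact (ha b h).le
    rw [lhS, Finset.mul_sum]
    refine Finset.sum_bij' (fun σ _ => Equiv.swap a b * σ) (fun σ _ => Equiv.swap a b * σ)
      ?_ ?_ ?_ ?_ ?_
    · intro σ hσ
      simp only [Finset.mem_filter, Finset.mem_univ, true_and] at hσ ⊢
      obtain ⟨⟨h2, hfix⟩, hσa⟩ := hσ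
      have hinv : ∀ i, σ (σ i) = i := fun i => by
        have := congrArg (fun τ : Equiv.Perm α => τ i) h2; simpa using this
      have hσb : σ b = a := by rw [← hσa, hinv]
      have hcomm : Equiv.swap a b * σ = σ * Equiv.swap a b := by
        rw [Equiv.mul_swap_eq_swap_mul, hσa, hσb, Equiv.swap_comm]
      constructor
      · calc Equiv.swap a b * σ * (Equiv.swap a b * σ)
            = Equiv.swap a b * (σ * Equiv.swap a b) * σ := by group
          _ = (Equiv.swap a b * Equiv.swap a b) * (σ * σ) := by rw [← hcomm]; group
          _ = 1 := by simp [h2]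
      · intro i hi
        simp only [Equiv.Perm.mul_apply]
        by_cases hia : i = a
        · subst hia; rw [hσa]; simp
        by_cases hib : i = b
        · subst hib; rw [hσb]; simp
        have : σ i = i := hfix i (by
          simp only [Finset.mem_insert, not_or]
          exact ⟨hia, fun h => hi (Finset.mem_erase.2 ⟨hib, h⟩)⟩)
        rw [this, Equiv.swap_apply_of_ne_of_ne hia hib]
    · intro σ hσ
      simp only [Finset.mem_filter, Finset.mem_univ, true_and] at hσ ⊢
      obtain ⟨h2, hfix⟩ := hσ
      have hσa : σ a = a := hfix a (fun h => hat (Finset.mem_of_mem_erase h))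
      have hσb : σ b = b := hfix b (by simp)
      have hcomm : Equiv.swap a b * σ = σ * Equiv.swap a b := by
        rw [Equiv.mul_swap_eq_swap_mul, hσa, hσb]
      refine ⟨⟨?_, ?_⟩, ?_⟩
      · calc Equiv.swap a b * σ * (Equiv.swap a b * σ)
            = Equiv.swap a b * (σ * Equiv.swap a b) * σ := by group
          _ = (Equiv.swap a b * Equiv.swap a b) * (σ * σ) := by rw [← hcomm]; group
          _ = 1 := by simp [h2]
      · intro i hi
        have hia : i ≠ a := fun h => hi (by simp [h])
        have hib : i ≠ b := fun h => hi (h ▸ hb)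
        have : σ i = i := hfix i (fun h => hi (Finset.mem_insert_of_mem (Finset.mem_of_mem_erase h)))
        simp only [Equiv.Perm.mul_apply]
        rw [this, Equiv.swap_apply_of_ne_of_ne hia hib]
      · simp [hσa]
    · intro σ _; simp [← mul_assoc]
    · intro σ _; simp [← mul_assoc]
    · intro σ hσ
      simp only [Finset.mem_filter, Finset.mem_univ, true_and] at hσ
      obtain ⟨⟨h2, hfix⟩, hσa⟩ := hσ
      have hinv : ∀ i, σ (σ i) = i := fun i => by
        have := congrArg (fun τ : Equiv.Perm α => τ i) h2; simpa using this
      have hσb : σ b = a := by rw [← hσa, hinv]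
      have hne : ∀ i ∈ t.erase b, (Equiv.swap a b * σ) i = σ i := by
        intro i hi
        have hib : i ≠ b := Finset.ne_of_mem_erase hi
        have hia : i ≠ a := fun h => hat (h ▸ Finset.mem_of_mem_erase hi)
        rw [Equiv.Perm.mul_apply, Equiv.swap_apply_of_ne_of_ne]
        · intro h; apply hib; rw [← hσa, ← h, hinv]
        · intro h; apply hia; rw [← hσb, ← h, hinv]
      have hset : (insert a t).filter (fun i => i ≤ σ i)
          = insert a ((t.erase b).filter (fun i => i ≤ (Equiv.swap a b * σ) i)) := by
        ext i
        simp only [Finset.mem_filter, Finset.mem_insert]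
        constructor
        · rintro ⟨rfl | hi, hle⟩
          · exact Or.inl rfl
          · right
            have hib : i ≠ b := by
              rintro rfl
              rw [hσb] at hle
              exact absurd (ha i hi) (not_lt.2 hle)
            have hm := Finset.mem_erase.2 ⟨hib, hi⟩
            exact ⟨hm, by rw [hne i hm]; exact hle⟩
        · rintro (rfl | ⟨hi, hle⟩)
          · exact ⟨Or.inl rfl, by rw [hσa]; exact hab⟩
          · rw [hne i hi] at hle
            exact ⟨Or.inr (Finset.mem_of_mem_erase hi), hle⟩
      rw [hset, Finset.prod_insert (fun h => hat
        (Finset.mem_of_mem_erase (Finset.mem_filter.1 h).1)), hσa]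
      congr 1
      apply Finset.prod_congr rfl
      intro i hi
      rw [hne i (Finset.mem_filter.1 hi).1]
  have hmaps : ∀ σ ∈ Finset.univ.filter
        (fun σ : Equiv.Perm α => σ * σ = 1 ∧ ∀ i, i ∉ insert a t → σ i = i),
      σ a ∈ insert a t := by
    intro σ hσ
    simp only [Finset.mem_filter, Finset.mem_univ, true_and] at hσ
    by_contra h
    have h2 := hσ.2 _ h
    have h3 : σ a = a := σ.injective h2
    exact h (by simp [h3])
  rw [lhS, ← Finset.sum_fiberwise_of_maps_to hmaps, Finset.sum_congr rfl key,
    Finset.sum_insert hat, Finset.erase_eq_of_notMem hat]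

lemma lhS_mom {σ α : Type*} [Fintype α] [LinearOrder α] (A : Matrix σ σ ℂ) (γ : σ → ℂ)
    (H : MvPolynomial σ ℂ →ₗ[ℂ] ℂ) (hH : IsMom A γ H) (φ : α → σ) (n : ℕ) :
    ∀ s : Finset α, s.card = n →
    lhS (fun i j => if i = j then γ (φ i) else A (φ i) (φ j)) s
      = H (∏ i ∈ s, MvPolynomial.X (φ i)) := by
  induction n using Nat.strong_induction_on with
  | _ n ih =>
    intro s hs
    rcases s.eq_empty_or_nonempty with rfl | hne
    · simp [lhS_empty, hH.1]
    · obtain ⟨a, t, hat, rfl, hlt⟩ : ∃ a t, a ∉ t ∧ s = insert a t ∧ ∀ b ∈ t, a < b := by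
        refine ⟨s.min' hne, s.erase (s.min' hne), by simp, ?_, ?_⟩
        · rw [Finset.insert_erase (s.min'_mem hne)]
        · intro b hb
          exact Finset.min'_lt_of_mem_erase_min' _ _ hb
      rw [Finset.card_insert_of_notMem hat] at hs
      rw [lhS_insert _ _ _ hlt, Finset.prod_insert hat, hH.2, dl_prod, map_sum,
        ih t.card (by omega) t rfl]
      simp only [if_true]
      congr 1
      apply Finset.sum_congr rfl
      intro b hb
      rw [ih (t.erase b).card (by have := Finset.card_erase_lt_of_mem hb; omega) _ rfl,
        if_neg (hlt b hb).ne, ← MvPolynomial.smul_eq_C_mul, map_smul, smul_eq_mul]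

lemma lhafv_mom {σ : Type*} {d : ℕ} (A : Matrix σ σ ℂ) (γ : σ → ℂ)
    (H : MvPolynomial σ ℂ →ₗ[ℂ] ℂ) (hH : IsMom A γ H) (φ : Fin d → σ) :
    lhafv (A.submatrix φ φ) (γ ∘ φ) = H (∏ i, MvPolynomial.X (φ i)) := by
  rw [← lhS_mom A γ H hH φ _ Finset.univ rfl, lhafv, lhaf, lhS]
  simp [filldiag]

lemma prod_rep {M : ℕ} {R : Type*} [CommMonoid R] (n : Fin M → ℕ) (f : Fin M → R) :
    ∏ i, f (rep n i) = ∏ k, f k ^ n k := by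
  have h1 : ∏ i, f (rep n i) = ((repList n).map f).prod := by
    rw [← List.prod_ofFn]
    congr 1
    apply List.ext_get
    · simp [repList_length]
    · intro i h1 h2
      simp [rep]
  rw [h1, repList, List.map_flatMap, List.flatMap, List.prod_flatten, Fin.prod_univ_def,
    List.map_map]
  simp [Function.comp_def]

lemma prod_dbl {M : ℕ} {R : Type*} [CommMonoid R] (n : Fin M → ℕ) (f : Fin M ⊕ Fin M → R) :
    ∏ i, f (dbl n n i) = ∏ k, (f (Sum.inl k) * f (Sum.inr k)) ^ n k := by
  rw [← finSumFinEquiv.prod_comp]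
  simp only [dbl, Function.comp, Equiv.symm_apply_apply, Fintype.prod_sum_type, Sum.map_inl,
    Sum.map_inr]
  rw [prod_rep n (fun k => f (Sum.inl k)), prod_rep n (fun k => f (Sum.inr k)),
    ← Finset.prod_mul_distrib]
  simp only [mul_pow]

/-- The left-hand side as a moment of a power. -/
lemma lhs_mom {M : ℕ} (A : Matrix (Fin M ⊕ Fin M) (Fin M ⊕ Fin M) ℂ)
    (γ : Fin M ⊕ Fin M → ℂ) (Y : Finset (Fin M)) (N : ℕ)
    (H : MvPolynomial (Fin M ⊕ Fin M) ℂ →ₗ[ℂ] ℂ) (hH : IsMom A γ H) :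
    ∑ n ∈ (Fintype.piFinset fun _ : Fin M => Finset.range (N + 1)).filter
        (fun n => (∀ k, k ∉ Y → n k = 0) ∧ ∑ i, n i = N),
      lhafv (repMat A n n) (repVec γ n n) / ∏ i, ((n i).factorial : ℂ)
    = H ((∑ k ∈ Y, MvPolynomial.X (Sum.inl k) * MvPolynomial.X (Sum.inr k)) ^ N)
        / (N.factorial : ℂ) := by
  have hset : (Fintype.piFinset fun _ : Fin M => Finset.range (N + 1)).filter
        (fun n => (∀ k, k ∉ Y → n k = 0) ∧ ∑ i, n i = N) = Finset.piAntidiag Y N := by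
    ext n
    simp only [Finset.mem_filter, Fintype.mem_piFinset, Finset.mem_range, Finset.mem_piAntidiag]
    constructor
    · rintro ⟨-, h0, hs⟩
      refine ⟨?_, fun i hi => by_contra fun h => hi (h0 i h)⟩
      rw [← hs]
      exact Finset.sum_subset (Finset.subset_univ _) (fun i _ hi => h0 i hi)
    · rintro ⟨hs, h0⟩
      have h0' : ∀ k, k ∉ Y → n k = 0 := fun k hk => by_contra fun h => hk (h0 k h)
      have hs' : ∑ i, n i = N := by
        rw [← hs]
        exact (Finset.sum_subset (Finset.subset_univ _) (fun i _ hi => h0' i hi)).symm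
      refine ⟨fun i => ?_, h0', hs'⟩
      have := Finset.single_le_sum (f := n) (fun _ _ => Nat.zero_le _) (Finset.mem_univ i)
      omega
  rw [hset, Finset.sum_pow_eq_sum_piAntidiag, map_sum, Finset.sum_div]
  apply Finset.sum_congr rfl
  intro n hn
  rw [Finset.mem_piAntidiag] at hn
  obtain ⟨hs, h0⟩ := hn
  have h0' : ∀ k, k ∉ Y → n k = 0 := fun k hk => by_contra fun h => hk (h0 k h)
  rw [repMat, repVec, lhafv_mom A γ H hH, prod_dbl n (fun i => MvPolynomial.X i)]
  have e1 : ∏ k, ((MvPolynomial.X (Sum.inl k) * MvPolynomial.X (Sum.inr k) :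
      MvPolynomial (Fin M ⊕ Fin M) ℂ)) ^ n k
      = ∏ k ∈ Y, (MvPolynomial.X (Sum.inl k) * MvPolynomial.X (Sum.inr k)) ^ n k :=
    (Finset.prod_subset (Finset.subset_univ _) (fun i _ hi => by simp [h0' i hi])).symm
  have e2 : ∏ i, ((n i).factorial : ℂ) = ∏ i ∈ Y, ((n i).factorial : ℂ) :=
    (Finset.prod_subset (Finset.subset_univ _) (fun i _ hi => by simp [h0' i hi])).symm
  have e3 := Nat.multinomial_spec Y n
  rw [hs] at e3
  have e4 : (∏ i ∈ Y, ((n i).factorial : ℂ)) * (Nat.multinomial Y n : ℂ) = N.factorial := by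
    exact_mod_cast e3
  rw [e1, e2, ← nsmul_eq_mul, map_nsmul, nsmul_eq_mul, ← e4]
  have h5 : (∏ i ∈ Y, ((n i).factorial : ℂ)) ≠ 0 :=
    Finset.prod_ne_zero_iff.2 fun i _ => by exact_mod_cast (n i).factorial_ne_zero
  have h6 : (Nat.multinomial Y n : ℂ) ≠ 0 := by
    intro h; rw [h, mul_zero] at e4
    exact N.factorial_ne_zero (by exact_mod_cast e4.symm)
  field_simp

section recursion

variable {ι : Type*} [Fintype ι] [DecidableEq ι]

/-- The quadratic polynomial `∑ k, x_k y_k`. -/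
def qp (ι : Type*) [Fintype ι] : MvPolynomial (ι ⊕ ι) ℂ :=
  ∑ k : ι, MvPolynomial.X (Sum.inl k) * MvPolynomial.X (Sum.inr k)

lemma mul_Xmat_inl (A : Matrix (ι ⊕ ι) (ι ⊕ ι) ℂ) (a : ι ⊕ ι) (k : ι) :
    (A * Xmat ι ℂ) a (Sum.inl k) = A a (Sum.inr k) := by
  simp [Matrix.mul_apply, Xmat, Matrix.one_apply]

lemma mul_Xmat_inr (A : Matrix (ι ⊕ ι) (ι ⊕ ι) ℂ) (a : ι ⊕ ι) (k : ι) :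
    (A * Xmat ι ℂ) a (Sum.inr k) = A a (Sum.inl k) := by
  simp [Matrix.mul_apply, Xmat, Matrix.one_apply]

lemma dl_qp (A : Matrix (ι ⊕ ι) (ι ⊕ ι) ℂ) (a : ι ⊕ ι) :
    dl A a (qp ι) = ∑ b, MvPolynomial.C ((A * Xmat ι ℂ) a b) * MvPolynomial.X b := by
  rw [Fintype.sum_sum_type, ← Finset.sum_add_distrib, qp, map_sum]
  apply Finset.sum_congr rfl
  intro k _
  rw [dl_X_mul, dl_X, mul_Xmat_inl, mul_Xmat_inr]
  ring

lemma dl_qp_pow (A : Matrix (ι ⊕ ι) (ι ⊕ ι) ℂ) (a : ι ⊕ ι) (N : ℕ) :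
    dl A a (qp ι ^ (N + 1)) = ((N : ℂ) + 1) •
      ∑ b, (A * Xmat ι ℂ) a b • (MvPolynomial.X b * qp ι ^ N) := by
  rw [Derivation.leibniz_pow, dl_qp]
  simp only [MvPolynomial.smul_eq_C_mul, nsmul_eq_mul, Nat.add_sub_cancel, smul_eq_mul,
    Finset.mul_sum]
  apply Finset.sum_congr rfl
  intro b _
  push_cast
  simp only [map_add, map_natCast, map_one]
  ring

lemma trans_Xmat : (Xmat ι ℂ)ᵀ = Xmat ι ℂ := by
  simp [Xmat, Matrix.fromBlocks_transpose]

/-- zeroth moment coefficients -/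
def mS (H : MvPolynomial (ι ⊕ ι) ℂ →ₗ[ℂ] ℂ) (N : ℕ) : ℂ := H (qp ι ^ N) / N.factorial
/-- first moment coefficients -/
def mV (H : MvPolynomial (ι ⊕ ι) ℂ →ₗ[ℂ] ℂ) (N : ℕ) (a : ι ⊕ ι) : ℂ :=
  H (MvPolynomial.X a * qp ι ^ N) / N.factorial
/-- second moment coefficients -/
def mC (H : MvPolynomial (ι ⊕ ι) ℂ →ₗ[ℂ] ℂ) (N : ℕ) : Matrix (ι ⊕ ι) (ι ⊕ ι) ℂ :=
  Matrix.of fun a b => H (MvPolynomial.X a * (MvPolynomial.X b * qp ι ^ N)) / N.factorial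

variable {A : Matrix (ι ⊕ ι) (ι ⊕ ι) ℂ} {γ : ι ⊕ ι → ℂ}
  {H : MvPolynomial (ι ⊕ ι) ℂ →ₗ[ℂ] ℂ}

lemma mV_zero (hH : IsMom A γ H) : mV H 0 = mS H 0 • γ := by
  ext a
  simp [mV, mS, hH.2, mul_comm, hH.1]
  have := hH.2 a 1
  simpa [hH.1] using this

lemma mV_succ (hH : IsMom A γ H) (N : ℕ) :
    mV H (N + 1) = mS H (N + 1) • γ + (A * Xmat ι ℂ) *ᵥ mV H N := by
  ext a
  have hN : (N.factorial : ℂ) ≠ 0 := by exact_mod_cast N.factorial_ne_zero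
  have hN1 : (N : ℂ) + 1 ≠ 0 := by exact_mod_cast N.succ_ne_zero
  simp only [mV, mS, Pi.add_apply, Pi.smul_apply, smul_eq_mul, Matrix.mulVec, dotProduct]
  rw [hH.2, dl_qp_pow, map_smul, map_sum, Nat.factorial_succ]
  simp only [map_smul, smul_eq_mul, ← mul_div_assoc, ← Finset.sum_div]
  push_cast
  field_simp

lemma mC_zero (hH : IsMom A γ H) :
    mC H 0 = Matrix.vecMulVec γ (mV H 0) + mS H 0 • A := by
  ext a b
  simp only [mC, mV, mS, Matrix.add_apply, Matrix.smul_apply, Matrix.vecMulVec_apply,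
    Matrix.of_apply]
  rw [hH.2 a, dl_X_mul, pow_zero, Derivation.map_one_eq_zero, mul_zero, zero_add,
    ← MvPolynomial.smul_eq_C_mul, map_smul]
  simp [mul_comm]

lemma mC_succ (hH : IsMom A γ H) (N : ℕ) :
    mC H (N + 1) = Matrix.vecMulVec γ (mV H (N + 1)) + mS H (N + 1) • A
      + (A * Xmat ι ℂ) * mC H N := by
  ext a b
  have hN : (N.factorial : ℂ) ≠ 0 := by exact_mod_cast N.factorial_ne_zero
  have hN1 : (N : ℂ) + 1 ≠ 0 := by exact_mod_cast N.succ_ne_zero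
  rw [Matrix.add_apply, Matrix.add_apply, Matrix.mul_apply]
  simp only [mC, mV, mS, Matrix.smul_apply, Matrix.vecMulVec_apply, Matrix.of_apply, smul_eq_mul]
  rw [hH.2 a, dl_X_mul, dl_qp_pow, map_add, ← MvPolynomial.smul_eq_C_mul, map_smul,
    mul_smul_comm, map_smul, Finset.mul_sum, map_sum, Nat.factorial_succ]
  have : ∀ c, H (MvPolynomial.X b * ((A * Xmat ι ℂ) a c • (MvPolynomial.X c * qp ι ^ N)))
      = (A * Xmat ι ℂ) a c * H (MvPolynomial.X c * (MvPolynomial.X b * qp ι ^ N)) := by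
    intro c
    rw [mul_smul_comm, map_smul, smul_eq_mul, mul_left_comm]
  simp only [this, smul_eq_mul, ← mul_div_assoc, ← Finset.sum_div]
  push_cast
  field_simp
  ring

lemma mS_succ (N : ℕ) :
    2 * ((N : ℂ) + 1) * mS H (N + 1) = Matrix.trace (Xmat ι ℂ * mC H N) := by
  have hN : (N.factorial : ℂ) ≠ 0 := by exact_mod_cast N.factorial_ne_zero
  have hN1 : (N : ℂ) + 1 ≠ 0 := by exact_mod_cast N.succ_ne_zero
  have hsymm : ∀ a b, mC H N a b = mC H N b a := by
    intro a b; simp only [mC, Matrix.of_apply]; rw [mul_left_comm]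
  have h1 : Matrix.trace (Xmat ι ℂ * mC H N) = 2 * ∑ k, mC H N (Sum.inl k) (Sum.inr k) := by
    rw [Matrix.trace_mul_comm, Matrix.trace, Fintype.sum_sum_type]
    simp only [Matrix.diag_apply, mul_Xmat_inl, mul_Xmat_inr]
    simp only [hsymm (Sum.inr _) (Sum.inl _)]
    ring
  have h2 : H (qp ι ^ (N + 1)) = ∑ k, H (MvPolynomial.X (Sum.inl k) *
      (MvPolynomial.X (Sum.inr k) * qp ι ^ N)) := by
    rw [pow_succ', ← map_sum]
    conv_lhs => rw [qp, Finset.sum_mul]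
    simp only [mul_assoc, qp]
  rw [h1, mS, h2, Nat.factorial_succ]
  simp only [mC, Matrix.of_apply, ← Finset.sum_div]
  push_cast
  field_simp

lemma mV_closed (hH : IsMom A γ H) (N : ℕ) :
    mV H N = ∑ k ∈ Finset.range (N + 1), mS H (N - k) • ((A * Xmat ι ℂ) ^ k *ᵥ γ) := by
  induction N with
  | zero => simp [mV_zero hH]
  | succ N ih =>
    rw [mV_succ hH, ih, Finset.sum_range_succ' _ (N + 1), add_comm, Matrix.mulVec_sum]
    simp only [Nat.sub_zero, pow_zero, Matrix.one_mulVec]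
    congr 1
    apply Finset.sum_congr rfl
    intro k _
    rw [Matrix.mulVec_smul, Matrix.mulVec_mulVec, ← pow_succ', Nat.add_sub_add_right]

lemma mC_closed (hH : IsMom A γ H) (N : ℕ) :
    mC H N = ∑ k ∈ Finset.range (N + 1), (A * Xmat ι ℂ) ^ k *
      (Matrix.vecMulVec γ (mV H (N - k)) + mS H (N - k) • A) := by
  induction N with
  | zero => simp [mC_zero hH]
  | succ N ih =>
    rw [mC_succ hH, ih, Finset.sum_range_succ' _ (N + 1), add_comm, Finset.mul_sum]
    simp only [Nat.sub_zero, pow_zero, one_mul]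
    congr 1
    apply Finset.sum_congr rfl
    intro k _
    rw [← mul_assoc, ← pow_succ', Nat.add_sub_add_right]

lemma Xmat_mul_pow (k : ℕ) :
    Xmat ι ℂ * (A * Xmat ι ℂ) ^ k = (Xmat ι ℂ * A) ^ k * Xmat ι ℂ := by
  induction k with
  | zero => simp
  | succ k ih => rw [pow_succ, ← mul_assoc, ih, pow_succ]; simp only [mul_assoc]

/-- bilinear form coefficients -/
def wv (A : Matrix (ι ⊕ ι) (ι ⊕ ι) ℂ) (γ : ι ⊕ ι → ℂ) (k : ℕ) : ℂ :=
  γ ⬝ᵥ Matrix.mulVec ((Xmat ι ℂ * A) ^ k * Xmat ι ℂ) γ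

lemma dot_wv (hA : A.IsSymm) (j k : ℕ) :
    (((Xmat ι ℂ * A) ^ k * Xmat ι ℂ) *ᵥ γ) ⬝ᵥ ((A * Xmat ι ℂ) ^ j *ᵥ γ) = wv A γ (k + j) := by
  have hT : ((A * Xmat ι ℂ) ^ j)ᵀ = (Xmat ι ℂ * A) ^ j := by
    rw [Matrix.transpose_pow, Matrix.transpose_mul, trans_Xmat, hA.eq]
  rw [dotProduct_comm, ← Matrix.vecMul_transpose, hT, ← Matrix.dotProduct_mulVec,
    Matrix.mulVec_mulVec, wv, ← mul_assoc, ← pow_add, add_comm]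

lemma mS_rec (hA : A.IsSymm) (hH : IsMom A γ H) (N : ℕ) :
    2 * ((N : ℂ) + 1) * mS H (N + 1) = ∑ k ∈ Finset.range (N + 1),
      (Matrix.trace ((Xmat ι ℂ * A) ^ (k + 1)) + ((k : ℂ) + 1) * wv A γ k) * mS H (N - k) := by
  rw [mS_succ, mC_closed hH, Finset.mul_sum, Matrix.trace_sum]
  have h1 : ∀ k ∈ Finset.range (N + 1), Matrix.trace (Xmat ι ℂ * ((A * Xmat ι ℂ) ^ k *
      (Matrix.vecMulVec γ (mV H (N - k)) + mS H (N - k) • A)))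
      = Matrix.trace ((Xmat ι ℂ * A) ^ (k + 1)) * mS H (N - k)
        + ∑ j ∈ Finset.range (N + 1 - k), mS H (N - (k + j)) * wv A γ (k + j) := by
    intro k hk
    have hk' : N + 1 - k = N - k + 1 := by
      have := Finset.mem_range.1 hk; omega
    rw [← mul_assoc, Xmat_mul_pow, mul_add, Matrix.trace_add, Matrix.mul_vecMulVec,
      Matrix.trace_vecMulVec, add_comm, hk', mul_smul_comm, Matrix.trace_smul, mul_assoc,
      ← pow_succ, smul_eq_mul, mul_comm, mV_closed hH, dotProduct_sum]
    congr 1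
    apply Finset.sum_congr rfl
    intro j _
    rw [dotProduct_smul, dot_wv hA, smul_eq_mul, Nat.sub_sub]
  rw [Finset.sum_congr rfl h1, Finset.sum_add_distrib,
    ← Finset.sum_range_diag_flip (N + 1) (fun k j => mS H (N - (k + j)) * wv A γ (k + j)),
    ← Finset.sum_add_distrib]
  apply Finset.sum_congr rfl
  intro m _
  rw [add_mul]
  congr 1
  have : ∀ k ∈ Finset.range (m + 1), mS H (N - (k + (m - k))) * wv A γ (k + (m - k))
      = mS H (N - m) * wv A γ m := by
    intro k hk
    have : k + (m - k) = m := by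
      have := Finset.mem_range.1 hk; omega
    rw [this]
  rw [Finset.sum_congr rfl this, Finset.sum_const, Finset.card_range, nsmul_eq_mul]
  push_cast
  ring

lemma gfun_eq (A : Matrix (ι ⊕ ι) (ι ⊕ ι) ℂ) (γ : ι ⊕ ι → ℂ) (k : ℕ) :
    2 * ((k : ℂ) + 1) * gfun A γ (fun _ => (1 : ℂ)) (k + 1)
      = Matrix.trace ((Xmat ι ℂ * A) ^ (k + 1)) + ((k : ℂ) + 1) * wv A γ k := by
  have hD : Dmat (fun _ : ι => (1 : ℂ)) = 1 := by
    rw [Dmat, ← Matrix.diagonal_one]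
    congr 1
    ext i
    cases i <;> rfl
  have hk : (k : ℂ) + 1 ≠ 0 := by exact_mod_cast k.succ_ne_zero
  rw [gfun, hD, one_mul, wv, Nat.add_sub_cancel]
  simp only [Ring.inverse_eq_inv']
  push_cast
  field_simp

lemma mS_rec' (hA : A.IsSymm) (hH : IsMom A γ H) (N : ℕ) :
    ((N : ℂ) + 1) * mS H (N + 1) = ∑ k ∈ Finset.range (N + 1),
      ((k : ℂ) + 1) * gfun A γ (fun _ => (1 : ℂ)) (k + 1) * mS H (N - k) := by
  have h := mS_rec hA hH N
  simp only [← gfun_eq] at h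
  have h2 : (2 : ℂ) ≠ 0 := two_ne_zero
  apply mul_left_cancel₀ h2
  rw [← mul_assoc, h, Finset.mul_sum]
  apply Finset.sum_congr rfl
  intro k _
  ring

end recursion

section expo

/-- The generating series of a sequence, without constant term. -/
def gs (g : ℕ → ℂ) : PowerSeries ℂ := PowerSeries.mk fun k => if k = 0 then 0 else g k

/-- Truncated exponential. -/
def te (g : ℕ → ℂ) (K : ℕ) : PowerSeries ℂ :=
  ∑ j ∈ Finset.range (K + 1), PowerSeries.C ((j.factorial : ℂ)⁻¹) * gs g ^ j

lemma coeff_gs_pow (g : ℕ → ℂ) (j n : ℕ) (h : n < j) :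
    PowerSeries.coeff n (gs g ^ j) = 0 := by
  have h1 : (PowerSeries.X : PowerSeries ℂ) ∣ gs g := by
    rw [PowerSeries.X_dvd_iff, ← PowerSeries.coeff_zero_eq_constantCoeff_apply]
    simp [gs]
  exact PowerSeries.X_pow_dvd_iff.1 (pow_dvd_pow_of_dvd h1 j) n h

lemma coeff_te (g : ℕ → ℂ) (K n : ℕ) (h : n ≤ K) :
    PowerSeries.coeff n (te g K) = PowerSeries.coeff n (te g n) := by
  induction K, h using Nat.le_induction with
  | base => rfl
  | succ K hK ih =>
    rw [← ih, te, Finset.sum_range_succ, map_add, PowerSeries.coeff_C_mul,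
      coeff_gs_pow g _ _ (by omega), mul_zero, add_zero, te]

lemma deriv_te (g : ℕ → ℂ) (K : ℕ) :
    PowerSeries.derivative ℂ (te g (K + 1)) = te g K * PowerSeries.derivative ℂ (gs g) := by
  rw [te, Finset.sum_range_succ', map_add, map_sum, te, Finset.sum_mul]
  simp only [pow_zero, mul_one]
  have : PowerSeries.derivative ℂ (PowerSeries.C (((Nat.factorial 0 : ℕ) : ℂ)⁻¹)) = 0 := by
    exact PowerSeries.derivative_C
  rw [this, add_zero]
  apply Finset.sum_congr rfl
  intro j _
  rw [← PowerSeries.smul_eq_C_mul, Derivation.map_smul, Derivation.leibniz_pow,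
    Nat.add_sub_cancel, ← PowerSeries.smul_eq_C_mul, Nat.factorial_succ, smul_mul_assoc,
    ← Nat.cast_smul_eq_nsmul ℂ, smul_smul, smul_eq_mul]
  congr 1
  have h1 : (j.factorial : ℂ) ≠ 0 := by exact_mod_cast j.factorial_ne_zero
  have h2 : (j : ℂ) + 1 ≠ 0 := by exact_mod_cast j.succ_ne_zero
  push_cast
  field_simp

lemma te_rec (g : ℕ → ℂ) (N : ℕ) :
    ((N : ℂ) + 1) * PowerSeries.coeff (N + 1) (te g (N + 1)) = ∑ k ∈ Finset.range (N + 1),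
      ((k : ℂ) + 1) * g (k + 1) * PowerSeries.coeff (N - k) (te g (N - k)) := by
  have h := congrArg (PowerSeries.coeff N) (deriv_te g N)
  rw [PowerSeries.coeff_derivative, mul_comm (te g N), PowerSeries.coeff_mul,
    Finset.Nat.sum_antidiagonal_eq_sum_range_succ_mk] at h
  rw [mul_comm, h]
  apply Finset.sum_congr rfl
  intro k _
  rw [coeff_te g N (N - k) (by omega), PowerSeries.coeff_derivative]
  simp [gs, mul_comm]

lemma te_unique (g S : ℕ → ℂ) (h0 : S 0 = 1)
    (hS : ∀ N : ℕ, ((N : ℂ) + 1) * S (N + 1) = ∑ k ∈ Finset.range (N + 1),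
      ((k : ℂ) + 1) * g (k + 1) * S (N - k)) (N : ℕ) :
    S N = PowerSeries.coeff N (te g N) := by
  induction N using Nat.strong_induction_on with
  | _ N ih =>
    cases N with
    | zero => simp [te, h0]
    | succ N =>
      have hN : (N : ℂ) + 1 ≠ 0 := by exact_mod_cast N.succ_ne_zero
      apply mul_left_cancel₀ hN
      rw [hS, te_rec]
      apply Finset.sum_congr rfl
      intro k _
      rw [ih (N - k) (by omega)]

lemma fN_eq_te {ι : Type*} [Fintype ι] [DecidableEq ι] (N : ℕ)
    (A : Matrix (ι ⊕ ι) (ι ⊕ ι) ℂ) (γ : ι ⊕ ι → ℂ) (z : ι → ℂ) :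
    fN N A γ z = PowerSeries.coeff N (te (gfun A γ z) N) := by
  set P : Polynomial ℂ :=
    ∑ k ∈ Finset.Icc 1 N, Polynomial.C (gfun A γ z k) * Polynomial.X ^ k with hP
  have hcoe : ∀ n, n < N + 1 → P.coeff n = PowerSeries.coeff n (gs (gfun A γ z)) := by
    intro n hn
    simp only [hP, Polynomial.finsetSum_coeff, Polynomial.coeff_C_mul, Polynomial.coeff_X_pow,
      gs, PowerSeries.coeff_mk, mul_ite, mul_one, mul_zero, Finset.sum_ite_eq, Finset.mem_Icc]
    by_cases h : n = 0
    · simp [h]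
    · rw [if_neg h, if_pos (by omega)]
  have hd : (PowerSeries.X : PowerSeries ℂ) ^ (N + 1) ∣ (P : PowerSeries ℂ) - gs (gfun A γ z) := by
    rw [PowerSeries.X_pow_dvd_iff]
    intro n hn
    rw [map_sub, Polynomial.coeff_coe, hcoe n hn, sub_self]
  have hpow : ∀ j, (P ^ j).coeff N = PowerSeries.coeff N (gs (gfun A γ z) ^ j) := by
    intro j
    have h := PowerSeries.X_pow_dvd_iff.1
      (hd.trans (sub_dvd_pow_sub_pow (P : PowerSeries ℂ) (gs (gfun A γ z)) j)) N (by omega)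
    rw [map_sub, sub_eq_zero, ← Polynomial.coe_pow, Polynomial.coeff_coe] at h
    exact h
  rw [fN, te, map_sum, Polynomial.finsetSum_coeff]
  apply Finset.sum_congr rfl
  intro j _
  rw [Polynomial.coeff_C_mul, PowerSeries.coeff_C_mul, ← hpow, Ring.inverse_eq_inv']

end expo

lemma mom_eq_fN {ι : Type*} [Fintype ι] [DecidableEq ι] (A : Matrix (ι ⊕ ι) (ι ⊕ ι) ℂ)
    (hA : A.IsSymm) (γ : ι ⊕ ι → ℂ) (H : MvPolynomial (ι ⊕ ι) ℂ →ₗ[ℂ] ℂ) (hH : IsMom A γ H)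
    (N : ℕ) : H (qp ι ^ N) / N.factorial = fN N A γ (fun _ => (1 : ℂ)) := by
  rw [fN_eq_te]
  exact te_unique _ (mS H) (by simp [mS, hH.1]) (mS_rec' hA hH) N

lemma IsMom.rename {σ τ : Type*} (f : τ → σ) {A : Matrix σ σ ℂ} {γ : σ → ℂ}
    {H : MvPolynomial σ ℂ →ₗ[ℂ] ℂ} (hH : IsMom A γ H) :
    IsMom (A.submatrix f f) (γ ∘ f) (H ∘ₗ (MvPolynomial.rename f).toLinearMap) := by
  have hd : ∀ a p, dl A (f a) (MvPolynomial.rename f p)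
      = MvPolynomial.rename f (dl (A.submatrix f f) a p) := by
    intro a p
    induction p using MvPolynomial.induction_on with
    | C c => simp [← MvPolynomial.algebraMap_eq]
    | add p q hp hq => simp only [map_add, hp, hq]
    | mul_X p i hp =>
      rw [mul_comm, map_mul, MvPolynomial.rename_X, dl_X_mul, hp, dl_X_mul]
      simp
  refine ⟨by simp [hH.1], fun a p => ?_⟩
  simp [hH.2, hd]

/-- Subset / total-photon-number reduction: for a subset `Y` of the modes, the sum of
`lhaf(A_{n⊕n}, γ_{n⊕n}) / Π_i n_i!` over all patterns `n` supported on `Y` with total `N`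
equals `f_N(A_Y, γ_Y, (1,…,1))`, where `A_Y`, `γ_Y` keep only the rows/columns (entries)
indexed by `k` and `M+k` for `k ∈ Y`. -/
theorem total_photon_number_subset (M : ℕ) (hM : 1 ≤ M)
    (A : Matrix (Fin M ⊕ Fin M) (Fin M ⊕ Fin M) ℂ) (hA : A.IsSymm)
    (γ : Fin M ⊕ Fin M → ℂ) (Y : Finset (Fin M)) (N : ℕ) :
    ∑ n ∈ (Fintype.piFinset fun _ : Fin M => Finset.range (N + 1)).filter
        (fun n => (∀ k, k ∉ Y → n k = 0) ∧ ∑ i, n i = N),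
      lhafv (repMat A n n) (repVec γ n n) / ∏ i, ((n i).factorial : ℂ)
      = fN N
          (A.submatrix (Sum.map (Y.orderEmbOfFin rfl) (Y.orderEmbOfFin rfl))
            (Sum.map (Y.orderEmbOfFin rfl) (Y.orderEmbOfFin rfl)))
          (γ ∘ Sum.map (Y.orderEmbOfFin rfl) (Y.orderEmbOfFin rfl))
          (fun _ : Fin Y.card => (1 : ℂ)) := by
  obtain ⟨H, hH⟩ := exists_mom A hA γ
  rw [lhs_mom A γ Y N H hH]
  rw [← mom_eq_fN _ (hA.submatrix _) _ _ (hH.rename _) N]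
  congr 1
  simp only [LinearMap.comp_apply, AlgHom.toLinearMap_apply, map_pow, qp, map_sum, map_mul,
    MvPolynomial.rename_X, Sum.map_inl, Sum.map_inr]
  congr 2
  conv_lhs => rw [← Finset.image_orderEmbOfFin_univ Y rfl]
  rw [Finset.sum_image (fun _ _ _ _ h => (Y.orderEmbOfFin rfl).injective h)]

end
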